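/- f(3,2) = 29: every binary word of length 29 encounters Z₃ = abacaba, and there exists a binary word of length 28 (e.g., 0010010011011011111100000011) that avoids Z₃. -/

import Mathlib

/-- `W` is an instance of the pattern `V`: the image of `V` under a semigroup
homomorphism sending each letter to a nonempty word. -/
def IsInst {α β : Type} (V : List α) (W : List β) : Prop :=
  ∃ φ : α → List β, (∀ a ∈ V, φ a ≠ []) ∧ W = (V.map φ).flatten

/-- `U` encounters `V`: some contiguous subword (infix) of `U` is an instance of `V`. -/
def Encounters {α β : Type} (U : List β) (V : List α) : Prop :=
  ∃ W : List β, W <:+: U ∧ IsInst V W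

/-- `U` avoids `V`: `U` does not encounter `V`. -/
def Avoids {α β : Type} (U : List β) (V : List α) : Prop :=
  ¬ Encounters U V

/-- The Zimin words over the alphabet ℕ: `Z₀ = ε`, `Z_{n+1} = Zₙ · n · Zₙ`. -/
def Zimin : ℕ → List ℕ
  | 0 => []
  | n + 1 => Zimin n ++ n :: Zimin n

/-- `zimf n q` is the smallest `M` such that every `q`-ary word of length `M`
encounters the Zimin word `Zₙ`. -/
noncomputable def zimf (n q : ℕ) : ℕ :=
  sInf {M : ℕ | ∀ W : List (Fin q), W.length = M → Encounters W (Zimin n)}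

/-- `ZC n q M` is the set of `q`-ary words of length `M` that are instances of `Zₙ`. -/
def ZC (n q M : ℕ) : Set (List (Fin q)) :=
  {W | W.length = M ∧ IsInst (Zimin n) W}

/-- `a B a C a B a` with `a` a letter already captures `Z₃`: the tail of a longer image of the
first letter can be absorbed into the neighbouring factors. -/
theorem encounters_zimin_three_iff {β : Type} {U : List β} :
    Encounters U (Zimin 3) ↔ ∃ (s : List β) (a : β) (B C t : List β), B ≠ [] ∧ C ≠ [] ∧
      U = s ++ (a :: (B ++ [a])) ++ C ++ (a :: (B ++ [a])) ++ t := by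
  constructor
  · rintro ⟨W, ⟨s, t, rfl⟩, φ, hφ, rfl⟩
    have h0 : φ 0 ≠ [] := hφ 0 (by decide)
    have h1 : φ 1 ≠ [] := hφ 1 (by decide)
    have h2 : φ 2 ≠ [] := hφ 2 (by decide)
    obtain ⟨a, A, hA⟩ := List.exists_cons_of_ne_nil h0
    exact ⟨s, a, A ++ φ 1, A ++ φ 2, A ++ t, by simp [h1], by simp [h2], by simp [Zimin, hA]⟩
  · rintro ⟨s, a, B, C, t, hB, hC, rfl⟩
    refine ⟨(a :: (B ++ [a])) ++ C ++ (a :: (B ++ [a])), ⟨s, t, by simp⟩,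
      fun n => if n = 0 then [a] else if n = 1 then B else C, ?_, by simp [Zimin]⟩
    intro n _
    dsimp only
    split_ifs <;> simp [hB, hC]

theorem Encounters.of_infix {α β : Type} {U U' : List β} {V : List α} (h : Encounters U V)
    (hU : U <:+: U') : Encounters U' V := by
  obtain ⟨W, hW, hi⟩ := h
  exact ⟨W, hW.trans hU, hi⟩

theorem Encounters.map {α β γ : Type} {U : List β} {V : List α} (h : Encounters U V)
    (g : β → γ) : Encounters (U.map g) V := by
  obtain ⟨W, hW, φ, hφ, rfl⟩ := h
  refine ⟨_, hW.map g, fun a => (φ a).map g, fun a ha => by simpa using hφ a ha, ?_⟩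
  simp [List.map_flatten, Function.comp_def]

/-- A word starting with `a B a` in which `a B a` occurs again after a nonempty gap encounters
`Z₃`. -/
theorem encounters_of_prefix_of_infix_drop {β : Type} {w : List β} {a : β} {B : List β} {m : ℕ}
    (hB : B ≠ []) (hm : B.length + 3 = m) (hpre : a :: (B ++ [a]) <+: w)
    (hinf : a :: (B ++ [a]) <:+: w.drop m) : Encounters w (Zimin 3) := by
  obtain ⟨r, rfl⟩ := hpre
  obtain ⟨s, t, hst⟩ := hinf
  have hr : r.drop 1 = s ++ a :: (B ++ [a]) ++ t := by
    have hlen : m = (a :: (B ++ [a])).length + 1 := by simp; omega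
    rw [hst, hlen, List.drop_length_add_append]
  cases r with
  | nil => simp at hr
  | cons c r =>
    rw [List.drop_one, List.tail_cons] at hr
    exact encounters_zimin_three_iff.mpr ⟨[], a, B, c :: s, t, hB, by simp, by simp [hr]⟩

/-- Test whether an optional letter is the letter `x`. -/
def isLetter : Bool → Option Bool → Bool
  | true, some true => true
  | false, some false => true
  | _, _ => false

theorem isLetter_eq_true_iff {x : Bool} {a : Option Bool} : isLetter x a = true ↔ a = some x := by
  rcases x with _ | _ <;> rcases a with _ | _ | _ <;> simp [isLetter]

/-- Test whether the optional letters `a b c` spell the word `x y z`. -/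
def spells₃ (x y z : Bool) (a b c : Option Bool) : Bool :=
  isLetter x a && (isLetter y b && isLetter z c)

/-- Test whether the optional letters `a b c d` spell the word `x y z t`. -/
def spells₄ (x y z t : Bool) (a b c d : Option Bool) : Bool :=
  isLetter x a && spells₃ y z t b c d

theorem cons_prefix_drop {β : Type} {w l : List β} {x : β} {m : ℕ} (hx : w[m]? = some x)
    (hl : l <+: w.drop (m + 1)) : x :: l <+: w.drop m := by
  obtain ⟨hm, rfl⟩ := List.getElem?_eq_some_iff.mp hx
  rw [List.drop_eq_getElem_cons hm]
  exact (List.prefix_cons_inj _).mpr hl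

theorem prefix_drop_of_spells₃ {x y z : Bool} {w : List Bool} (m : ℕ)
    (h : spells₃ x y z w[m]? w[m + 1]? w[m + 2]? = true) : [x, y, z] <+: w.drop m := by
  simp only [spells₃, Bool.and_eq_true, isLetter_eq_true_iff] at h
  exact cons_prefix_drop h.1 (cons_prefix_drop h.2.1 (cons_prefix_drop h.2.2 List.nil_prefix))

theorem prefix_drop_of_spells₄ {x y z t : Bool} {w : List Bool} (m : ℕ)
    (h : spells₄ x y z t w[m]? w[m + 1]? w[m + 2]? w[m + 3]? = true) :
    [x, y, z, t] <+: w.drop m := by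
  simp only [spells₄, Bool.and_eq_true, isLetter_eq_true_iff] at h
  exact cons_prefix_drop h.1 (prefix_drop_of_spells₃ (m + 1) h.2)

/-- Function application that makes the kernel evaluate the Boolean argument first. -/
def force : Bool → (Bool → Bool) → Bool
  | false, k => k false
  | true, k => k true

theorem force_eq (b : Bool) (k : Bool → Bool) : force b k = k b := by
  cases b <;> rfl

/-- Backtracking search showing that all long enough extensions to the left of a binary word `w`
encounter `Z₃`. The arguments `a, …, i` are the first nine letters of `w` (`none` past its end);
`p, q, r, s, t, u` record which of the words `000`, `010`, `101`, `111`, `0110`, `1001`, the minimal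
binary instances of `Z₂`, occur in `w` after the place where a gap of length at least one separates
them from an occurrence at the start of `w`. A branch is closed as soon as `w` starts with a
recorded word. -/
def unavoidable : ℕ → (a b c d e f g h i : Option Bool) → (p q r s t u : Bool) → Bool
  | 0, _, _, _, _, _, _, _, _, _, _, _, _, _, _, _ => false
  | n + 1, a, b, c, d, e, f, g, h, i, p, q, r, s, t, u =>
    force (p || spells₃ false false false e f g) fun p =>
    force (q || spells₃ false true false e f g) fun q =>
    force (r || spells₃ true false true e f g) fun r =>
    force (s || spells₃ true true true e f g) fun s =>
    force (t || spells₄ false true true false f g h i) fun t =>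
    force (u || spells₄ true false false true f g h i) fun u =>
    (p && spells₃ false false false a b c) || ((q && spells₃ false true false a b c) ||
    ((r && spells₃ true false true a b c) || ((s && spells₃ true true true a b c) ||
    ((t && spells₄ false true true false a b c d) ||
    ((u && spells₄ true false false true a b c d) ||
      (unavoidable n (some false) a b c d e f g h p q r s t u &&
        unavoidable n (some true) a b c d e f g h p q r s t u))))))

theorem encounters_of_unavoidable {n : ℕ} {w v : List Bool} {p q r s t u : Bool}
    (hp : p = true → [false, false, false] <:+: w.drop 4)
    (hq : q = true → [false, true, false] <:+: w.drop 4)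
    (hr : r = true → [true, false, true] <:+: w.drop 4)
    (hs : s = true → [true, true, true] <:+: w.drop 4)
    (ht : t = true → [false, true, true, false] <:+: w.drop 5)
    (hu : u = true → [true, false, false, true] <:+: w.drop 5)
    (h : unavoidable n w[0]? w[1]? w[2]? w[3]? w[4]? w[5]? w[6]? w[7]? w[8]? p q r s t u = true)
    (hv : n ≤ v.length + 1) : Encounters (v ++ w) (Zimin 3) := by
  induction n generalizing w v p q r s t u with
  | zero => simp [unavoidable] at h
  | succ n ih =>
    have record₃ {x y z p : Bool} (hp : p = true → [x, y, z] <:+: w.drop 4)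
        (h : (p || spells₃ x y z w[4]? w[5]? w[6]?) = true) : [x, y, z] <:+: w.drop 4 :=
      (Bool.or_eq_true _ _ ▸ h).elim hp fun h => (prefix_drop_of_spells₃ 4 h).isInfix
    have record₄ {x y z t p : Bool} (hp : p = true → [x, y, z, t] <:+: w.drop 5)
        (h : (p || spells₄ x y z t w[5]? w[6]? w[7]? w[8]?) = true) :
        [x, y, z, t] <:+: w.drop 5 :=
      (Bool.or_eq_true _ _ ▸ h).elim hp fun h => (prefix_drop_of_spells₄ 5 h).isInfix
    have close₃ {x y p : Bool} (hp : p = true → [x, y, x] <:+: w.drop 4)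
        (h : (p && spells₃ x y x w[0]? w[1]? w[2]?) = true) : Encounters (v ++ w) (Zimin 3) := by
      rw [Bool.and_eq_true] at h
      exact (encounters_of_prefix_of_infix_drop (B := [y]) (by simp) rfl
        (prefix_drop_of_spells₃ 0 h.2) (hp h.1)).of_infix (List.suffix_append v w).isInfix
    have close₄ {x y z p : Bool} (hp : p = true → [x, y, z, x] <:+: w.drop 5)
        (h : (p && spells₄ x y z x w[0]? w[1]? w[2]? w[3]?) = true) :
        Encounters (v ++ w) (Zimin 3) := by
      rw [Bool.and_eq_true] at h
      exact (encounters_of_prefix_of_infix_drop (B := [y, z]) (by simp) rfl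
        (prefix_drop_of_spells₄ 0 h.2) (hp h.1)).of_infix (List.suffix_append v w).isInfix
    have extend {f : List Bool} {m : ℕ} (b : Bool) (hf : f <:+: w.drop m) :
        f <:+: (b :: w).drop m :=
      by
      rw [← List.singleton_append, List.drop_append]
      cases m with
      | zero => exact hf.trans (List.suffix_append _ _).isInfix
      | succ m =>
        refine hf.trans (List.IsSuffix.isInfix ?_)
        simpa using List.drop_suffix_drop_left w (Nat.le_succ m)
    simp only [unavoidable, force_eq] at h
    replace hp := record₃ hp
    generalize (p || _) = p₁ at h hp
    replace hq := record₃ hq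
    generalize (q || _) = q₁ at h hq
    replace hr := record₃ hr
    generalize (r || _) = r₁ at h hr
    replace hs := record₃ hs
    generalize (s || _) = s₁ at h hs
    replace ht := record₄ ht
    generalize (t || _) = t₁ at h ht
    replace hu := record₄ hu
    generalize (u || _) = u₁ at h hu
    rcases (Bool.or_eq_true _ _).mp h with h | h
    · exact close₃ hp h
    rcases (Bool.or_eq_true _ _).mp h with h | h
    · exact close₃ hq h
    rcases (Bool.or_eq_true _ _).mp h with h | h
    · exact close₃ hr h
    rcases (Bool.or_eq_true _ _).mp h with h | h
    · exact close₃ hs h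
    rcases (Bool.or_eq_true _ _).mp h with h | h
    · exact close₄ ht h
    rcases (Bool.or_eq_true _ _).mp h with h | h
    · exact close₄ hu h
    obtain ⟨hfalse, htrue⟩ := (Bool.and_eq_true _ _).mp h
    rcases List.eq_nil_or_concat v with rfl | ⟨v, b, rfl⟩
    · obtain rfl : n = 0 := by simpa using hv
      simp [unavoidable] at hfalse
    · have hlen : n ≤ v.length + 1 := by simpa using hv
      rw [List.concat_eq_append, List.append_assoc, List.singleton_append]
      have hb : unavoidable n (some b) w[0]? w[1]? w[2]? w[3]? w[4]? w[5]? w[6]? w[7]?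
          p₁ q₁ r₁ s₁ t₁ u₁ = true := by
        cases b
        · exact hfalse
        · exact htrue
      exact ih (w := b :: w) (fun h => extend b (hp h)) (fun h => extend b (hq h))
        (fun h => extend b (hr h)) (fun h => extend b (hs h)) (fun h => extend b (ht h))
        (fun h => extend b (hu h)) hb hlen

theorem unavoidable_thirty : unavoidable 30 none none none none none none none none none
    false false false false false false = true := by
  decide +kernel

theorem encounters_of_length_eq (W : List (Fin 2)) (hW : W.length = 29) :
    Encounters W (Zimin 3) := by
  have h := (encounters_of_unavoidable (n := 30) (w := []) (v := W.map (· == 1)) (p := false)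
    (q := false) (r := false) (s := false) (t := false) (u := false) (by simp) (by simp) (by simp)
    (by simp) (by simp) (by simp) unavoidable_thirty (by simp [hW])).map
    (fun b => if b then (1 : Fin 2) else 0)
  have hid : (fun b : Bool => if b then (1 : Fin 2) else 0) ∘ (· == 1) = id := by
    funext x
    fin_cases x <;> rfl
  simpa [hid] using h

/-- A binary word of length 28 avoiding `Z₃`. -/
def avoidingWord : List (Fin 2) :=
  [0, 0, 1, 0, 0, 1, 0, 0, 1, 1, 0, 1, 1, 0, 1, 1, 1, 1, 1, 1, 0, 0, 0, 0, 0, 0, 1, 1]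

theorem avoidingWord_no_repeat : ∀ m < 12, ∀ i < 28, ∀ r < 28,
    ¬ (i + r + 2 * m + 7 ≤ 28 ∧ avoidingWord[i]? = avoidingWord[i + m + 2]? ∧
      (avoidingWord.drop i).take (m + 3) = (avoidingWord.drop (i + m + r + 4)).take (m + 3)) := by
  decide +kernel

theorem avoids_avoidingWord : Avoids avoidingWord (Zimin 3) := by
  intro h
  obtain ⟨s, a, B, C, t, hB, hC, h⟩ := encounters_zimin_three_iff.mp h
  obtain ⟨m, hm⟩ := Nat.exists_eq_succ_of_ne_zero (mt List.length_eq_zero_iff.mp hB)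
  obtain ⟨r, hr⟩ := Nat.exists_eq_succ_of_ne_zero (mt List.length_eq_zero_iff.mp hC)
  have hlen : 28 = (s ++ (a :: (B ++ [a])) ++ C ++ (a :: (B ++ [a])) ++ t).length := by
    rw [← h]; rfl
  simp only [List.length_append, List.length_cons, List.length_nil] at hlen
  have key (u v : List (Fin 2)) (h : avoidingWord = u ++ (a :: (B ++ [a])) ++ v) :
      (avoidingWord.drop u.length).take (m + 3) = a :: (B ++ [a]) := by
    rw [h, List.append_assoc, List.drop_left, List.take_left' (by simp; omega)]
  refine avoidingWord_no_repeat m (by omega) s.length (by omega) r (by omega) ⟨by omega, ?_, ?_⟩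
  · have h1 : s.length + m + 2 = (s ++ a :: B).length := by simp; omega
    have h2 : avoidingWord = (s ++ a :: B) ++ a :: (C ++ (a :: (B ++ [a])) ++ t) := by simp [h]
    have h3 : avoidingWord = s ++ a :: (B ++ [a] ++ C ++ (a :: (B ++ [a])) ++ t) := by simp [h]
    rw [h1]
    conv_lhs => rw [h3]
    conv_rhs => rw [h2]
    simp only [List.getElem?_append_right le_rfl, Nat.sub_self, List.getElem?_cons_zero]
  · have h1 : s.length + m + r + 4 = (s ++ (a :: (B ++ [a])) ++ C).length := by simp; omega
    rw [h1, key _ t h, key s (C ++ (a :: (B ++ [a])) ++ t) (by simp [h])]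

/-- `f(3,2) = 29`: every binary word of length 29 encounters `Z₃ = abacaba`, and the
binary word `0010010011011011111100000011` of length 28 avoids `Z₃`. -/
theorem zimf_three_two :
    zimf 3 2 = 29 ∧
    (∀ W : List (Fin 2), W.length = 29 → Encounters W (Zimin 3)) ∧
    Avoids ([0, 0, 1, 0, 0, 1, 0, 0, 1, 1, 0, 1, 1, 0, 1, 1, 1, 1, 1, 1, 0, 0, 0, 0, 0,
      0, 1, 1] : List (Fin 2)) (Zimin 3) := by
  refine ⟨le_antisymm (Nat.sInf_le encounters_of_length_eq) ?_, encounters_of_length_eq,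
    avoids_avoidingWord⟩
  refine le_csInf ⟨29, encounters_of_length_eq⟩ fun M hM => ?_
  by_contra hlt
  have hlen : avoidingWord.length = 28 := rfl
  exact avoids_avoidingWord ((hM (avoidingWord.take M) (by simp [hlen]; omega)).of_infix
    (List.take_prefix M avoidingWord).isInfix)
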